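/- Let M, N, K be positive integers, A ∈ ℝ^{M×N}, P ∈ ℝ^{M×K}, Q ∈ ℝ^{K×N}. Set c₁ = 3 and c₂ = ‖A‖_F, and define F(U,Z) = ⟨P,U⟩_F + ⟨Q,Z⟩_F + c₁·((‖U‖_F² + ‖Z‖_F²)/2)² + c₂·(‖U‖_F² + ‖Z‖_F²)/2 on ℝ^{M×K} × ℝ^{K×N}. If r ≥ 0 satisfies the cubic equation c₁(‖P‖_F² + ‖Q‖_F²)·r³ + c₂·r − 1 = 0, then (U*, Z*) = (−rP, −rQ) is a global minimizer of F. -/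

import Mathlib

/-- Frobenius inner product of real matrices. -/
noncomputable def fip {m n : ℕ} (X Y : Matrix (Fin m) (Fin n) ℝ) : ℝ :=
  ∑ i, ∑ j, X i j * Y i j

/-- Frobenius norm of a real matrix. -/
noncomputable def fnorm {m n : ℕ} (X : Matrix (Fin m) (Fin n) ℝ) : ℝ :=
  Real.sqrt (fip X X)

theorem fip_self_nonneg {m n : ℕ} (X : Matrix (Fin m) (Fin n) ℝ) : 0 ≤ fip X X :=
  Finset.sum_nonneg fun i _ => Finset.sum_nonneg fun j _ => mul_self_nonneg (X i j)

theorem fnorm_sq {m n : ℕ} (X : Matrix (Fin m) (Fin n) ℝ) : fnorm X ^ 2 = fip X X :=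
  Real.sq_sqrt (fip_self_nonneg X)

theorem fip_neg_smul_right {m n : ℕ} (r : ℝ) (X Y : Matrix (Fin m) (Fin n) ℝ) :
    fip X (-(r • Y)) = -r * fip X Y := by
  simp only [fip, Finset.mul_sum, Matrix.neg_apply, Matrix.smul_apply, smul_eq_mul]
  refine Finset.sum_congr rfl fun i _ => Finset.sum_congr rfl fun j _ => ?_
  ring

theorem fip_neg_smul_self {m n : ℕ} (r : ℝ) (X : Matrix (Fin m) (Fin n) ℝ) :
    fip (-(r • X)) (-(r • X)) = r ^ 2 * fip X X := by
  simp only [fip, Finset.mul_sum, Matrix.neg_apply, Matrix.smul_apply, smul_eq_mul]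
  refine Finset.sum_congr rfl fun i _ => Finset.sum_congr rfl fun j _ => ?_
  ring

theorem fip_add_smul_self {m n : ℕ} (r : ℝ) (U P : Matrix (Fin m) (Fin n) ℝ) :
    fip (U + r • P) (U + r • P) = fip U U + 2 * r * fip P U + r ^ 2 * fip P P := by
  simp only [fip, Finset.mul_sum, ← Finset.sum_add_distrib, Matrix.add_apply, Matrix.smul_apply,
    smul_eq_mul]
  refine Finset.sum_congr rfl fun i _ => Finset.sum_congr rfl fun j _ => ?_
  ring

/-- if r ≥ 0 solves 3(‖P‖²+‖Q‖²)r³ + ‖A‖_F r − 1 = 0, then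
(U*,Z*) = (−rP, −rQ) globally minimizes the BPG subproblem objective
F(U,Z) = ⟨P,U⟩ + ⟨Q,Z⟩ + 3((‖U‖²+‖Z‖²)/2)² + ‖A‖_F(‖U‖²+‖Z‖²)/2. -/
theorem stmt12 (M N K : ℕ) (hM : 0 < M) (hN : 0 < N) (hK : 0 < K)
    (A : Matrix (Fin M) (Fin N) ℝ)
    (P : Matrix (Fin M) (Fin K) ℝ) (Q : Matrix (Fin K) (Fin N) ℝ)
    (r : ℝ) (hr : 0 ≤ r)
    (hcubic : 3 * (fnorm P ^ 2 + fnorm Q ^ 2) * r ^ 3 + fnorm A * r - 1 = 0) :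
    ∀ (U : Matrix (Fin M) (Fin K) ℝ) (Z : Matrix (Fin K) (Fin N) ℝ),
      fip P (-(r • P)) + fip Q (-(r • Q)) +
          3 * ((fnorm (-(r • P)) ^ 2 + fnorm (-(r • Q)) ^ 2) / 2) ^ 2 +
          fnorm A * ((fnorm (-(r • P)) ^ 2 + fnorm (-(r • Q)) ^ 2) / 2) ≤
        fip P U + fip Q Z +
          3 * ((fnorm U ^ 2 + fnorm Z ^ 2) / 2) ^ 2 +
          fnorm A * ((fnorm U ^ 2 + fnorm Z ^ 2) / 2) := by
  intro U Z
  have hP := fip_add_smul_self r U P ▸ fip_self_nonneg (U + r • P)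
  have hQ := fip_add_smul_self r Z Q ▸ fip_self_nonneg (Z + r • Q)
  have hc : 0 ≤ fnorm A := Real.sqrt_nonneg _
  have hT : 0 ≤ fip P P + fip Q Q := add_nonneg (fip_self_nonneg P) (fip_self_nonneg Q)
  simp only [fnorm_sq, fip_neg_smul_self] at hcubic ⊢
  simp only [fip_neg_smul_right]
  set c := fnorm A
  set T := fip P P + fip Q Q with hTdef
  set s := fip U U + fip Z Z with hsdef
  set L := fip P U + fip Q Z with hLdef
  have hsq : 0 ≤ s + 2 * r * L + r ^ 2 * T := by linarith
  have hk : 0 ≤ 3 * (r ^ 2 * T) + c := by positivity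
  have hmul := mul_nonneg hk hsq
  have hgap := sq_nonneg (s - r ^ 2 * T)
  have hstar : r ^ 2 * fip P P + r ^ 2 * fip Q Q = r ^ 2 * T := by rw [hTdef]; ring
  have hlin : -r * fip P P + -r * fip Q Q = -r * T := by rw [hTdef]; ring
  rw [hstar, hlin]
  linear_combination hmul / 2 + 3 / 4 * hgap + (L + r * T) * hcubic
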